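/- Let c : ℝ^d × ℝ^d → ℝ be continuous with 0 ≤ c(x,y) ≤ C₁(‖x‖² + ‖y‖²) for all x, y ∈ ℝ^d and some C₁ > 0, let ε > 0 and fix μ ∈ 𝒫₂^r(ℝ^d) with H(μ) < ∞. Then the map ν ↦ W_{c,ε}(μ,ν) is strictly convex on 𝒫₂^r(ℝ^d): for all ν₀ ≠ ν₁ in 𝒫₂^r(ℝ^d) with H(ν₀), H(ν₁) < ∞ and all t ∈ (0,1), W_{c,ε}(μ, (1−t)ν₀ + tν₁) < (1−t) W_{c,ε}(μ,ν₀) + t W_{c,ε}(μ,ν₁). -/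

import Mathlib

open MeasureTheory Filter
open scoped ENNReal NNReal RealInnerProductSpace Topology Classical

noncomputable section

/-- `ℝ^d` with the Euclidean norm. -/
abbrev Euc (d : ℕ) : Type := EuclideanSpace ℝ (Fin d)

/-- Second moment `M(ρ) = ∫ ‖x‖² dρ`. -/
def M2 {α : Type*} [NormedAddCommGroup α] [MeasurableSpace α] (ρ : Measure α) : ℝ≥0∞ :=
  ∫⁻ x, (‖x‖₊ : ℝ≥0∞) ^ 2 ∂ρ

/-- `𝒫₂`: probability measures with finite second moment. -/
def IsP2 {α : Type*} [NormedAddCommGroup α] [MeasurableSpace α] (ρ : Measure α) : Prop :=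
  IsProbabilityMeasure ρ ∧ M2 ρ < ⊤

/-- the density of a measure w.r.t. the reference (Lebesgue) measure. -/
def dens {α : Type*} [MeasureSpace α] (ρ : Measure α) (x : α) : ℝ :=
  (ρ.rnDeriv volume x).toReal

/-- `𝒫₂^r`: absolutely continuous members of `𝒫₂`. -/
def IsP2r {α : Type*} [NormedAddCommGroup α] [MeasureSpace α] (ρ : Measure α) : Prop :=
  IsP2 ρ ∧ ρ ≪ (volume : Measure α)

/-- (negative Boltzmann) entropy `H(ρ) = ∫ ρ log ρ` if `ρ` is absolutely continuous
(`+∞` otherwise). -/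
def entropy {α : Type*} [MeasureSpace α] (ρ : Measure α) : EReal :=
  if ρ ≪ (volume : Measure α) ∧
      Integrable (fun x => dens ρ x * Real.log (dens ρ x)) (volume : Measure α)
  then ((∫ x, dens ρ x * Real.log (dens ρ x) ∂(volume : Measure α) : ℝ) : EReal)
  else ⊤

/-- `γ` is a coupling (transport plan) between `μ` and `ν`. -/
def IsCoupling {α : Type*} [MeasurableSpace α] (γ : Measure (α × α)) (μ ν : Measure α) : Prop :=
  γ.fst = μ ∧ γ.snd = ν

/-- `(c, γ) = ∫ c dγ` for a nonnegative cost. -/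
def costInt {α : Type*} [MeasurableSpace α] (c : α × α → ℝ) (γ : Measure (α × α)) : ℝ≥0∞ :=
  ∫⁻ p, ENNReal.ofReal (c p) ∂γ

/-- entropic regularised optimal transport cost `W_{c,ε}`. -/
def transportCost {α : Type*} [MeasureSpace α] (c : α × α → ℝ) (ε : ℝ)
    (μ ν : Measure α) : EReal :=
  ⨅ γ ∈ {γ : Measure (α × α) | IsCoupling γ μ ν},
    ((costInt c γ : EReal) + (ε : EReal) * entropy γ)

/-- potential part of the free energy, `F(ρ) = ∫ f dρ` (`f ≥ 0`). -/
def potentialEnergy {α : Type*} [MeasurableSpace α] (f : α → ℝ) (ρ : Measure α) : EReal :=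
  ((∫⁻ x, ENNReal.ofReal (f x) ∂ρ : ℝ≥0∞) : EReal)

/-- internal part of the free energy, `U(ρ) = ∫ u(ρ(x)) dx` (`+∞` if not a.c.). -/
def internalEnergy {α : Type*} [MeasureSpace α] (u : ℝ → ℝ) (ρ : Measure α) : EReal :=
  if ρ ≪ (volume : Measure α) ∧ Integrable (fun x => u (dens ρ x)) (volume : Measure α)
  then ((∫ x, u (dens ρ x) ∂(volume : Measure α) : ℝ) : EReal)
  else ⊤

/-- free energy `𝓕(ρ) = ∫ f dρ + ∫ u(ρ) dx`. -/
def freeEnergy {α : Type*} [MeasureSpace α] (f : α → ℝ) (u : ℝ → ℝ) (ρ : Measure α) : EReal :=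
  potentialEnergy f ρ + internalEnergy u ρ

/-- the JKO functional `ν ↦ (1/2h) W_{c,ε}(μ,ν) + 𝓕(ν)`. -/
def JKO {α : Type*} [MeasureSpace α] (c : α × α → ℝ) (h ε : ℝ) (f : α → ℝ) (u : ℝ → ℝ)
    (μ ν : Measure α) : EReal :=
  ((1 / (2 * h) : ℝ) : EReal) * transportCost c ε μ ν + freeEnergy f u ν

/-- divergence of a vector field (trace of the Jacobian). -/
def divg {d : ℕ} (F : Euc d → Euc d) (x : Euc d) : ℝ :=
  LinearMap.trace ℝ (Euc d) (fderiv ℝ F x).toLinearMap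

/-- the pressure `p(s) = u'(s) s - u(s)`. -/
def press (u : ℝ → ℝ) (s : ℝ) : ℝ := deriv u s * s - u s

/-- weak convergence of measures (against bounded continuous functions). -/
def WeakTendsto {α : Type*} [TopologicalSpace α] [MeasurableSpace α]
    (μs : ℕ → Measure α) (μ : Measure α) : Prop :=
  ∀ g : BoundedContinuousFunction α ℝ,
    Tendsto (fun k => ∫ x, g x ∂(μs k)) atTop (nhds (∫ x, g x ∂μ))

section Pointwise

/-- Fenchel–Young inequality for `x ↦ x log x`, in the form used for relative entropies. -/
lemma mul_log_fenchel_young {p q : ℝ} (hp : 0 ≤ p) (hq : 0 < q) (s : ℝ) :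
    p - q + (s * p - (Real.exp s - 1) * q) ≤ p * Real.log p - p * Real.log q := by
  rcases hp.eq_or_lt with rfl | hp
  · nlinarith [mul_pos (Real.exp_pos s) hq]
  · have hx : 0 < Real.exp s * q / p := by positivity
    have h := Real.log_le_sub_one_of_pos hx
    rw [Real.log_div (by positivity) hp.ne', Real.log_mul (Real.exp_pos s).ne' hq.ne',
      Real.log_exp] at h
    have h2 := mul_le_mul_of_nonneg_left h hp.le
    have h3 : p * (Real.exp s * q / p - 1) = Real.exp s * q - p := by field_simp
    linarith

lemma mul_log_convexComb_le {t p₀ p₁ : ℝ} (ht0 : 0 < t) (ht1 : t < 1) (h₀ : 0 ≤ p₀)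
    (h₁ : 0 ≤ p₁) (s : ℝ) :
    ((1 - t) * p₀ + t * p₁) * Real.log ((1 - t) * p₀ + t * p₁) +
        (1 - t) * (s * p₀ - (Real.exp s - 1) * ((1 - t) * p₀ + t * p₁)) ≤
      (1 - t) * (p₀ * Real.log p₀) + t * (p₁ * Real.log p₁) := by
  have h1t : 0 < 1 - t := by linarith
  have hq : 0 ≤ (1 - t) * p₀ + t * p₁ := by positivity
  rcases hq.eq_or_lt with hq | hq
  · have e0 : p₀ = 0 := by nlinarith [mul_nonneg h1t.le h₀, mul_nonneg ht0.le h₁]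
    have e1 : p₁ = 0 := by nlinarith [mul_nonneg h1t.le h₀, mul_nonneg ht0.le h₁]
    simp [e0, e1]
  · have a := mul_le_mul_of_nonneg_left (mul_log_fenchel_young h₀ hq s) h1t.le
    have b := mul_le_mul_of_nonneg_left (mul_log_fenchel_young h₁ hq 0) ht0.le
    rw [Real.exp_zero] at b
    linarith

lemma le_mul_log_convexComb {t p₀ p₁ : ℝ} (ht0 : 0 < t) (ht1 : t < 1) (h₀ : 0 ≤ p₀)
    (h₁ : 0 ≤ p₁) :
    (1 - t) * (p₀ * Real.log p₀) + t * (p₁ * Real.log p₁) +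
        ((1 - t) * Real.log (1 - t) * p₀ + t * Real.log t * p₁) ≤
      ((1 - t) * p₀ + t * p₁) * Real.log ((1 - t) * p₀ + t * p₁) := by
  have h1t : 0 < 1 - t := by linarith
  have key : ∀ {a p q : ℝ}, 0 < a → 0 ≤ p → a * p ≤ q →
      a * (p * Real.log p) + a * Real.log a * p ≤ a * p * Real.log q := by
    intro a p q ha hp hpq
    rcases hp.eq_or_lt with rfl | hp
    · simp
    · have := mul_le_mul_of_nonneg_left
        (Real.log_le_log (mul_pos ha hp) hpq) (mul_pos ha hp).le
      rw [Real.log_mul ha.ne' hp.ne'] at this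
      linarith
  have a := key (q := (1 - t) * p₀ + t * p₁) h1t h₀ (by nlinarith)
  have b := key (q := (1 - t) * p₀ + t * p₁) ht0 h₁ (by nlinarith)
  linarith

lemma exists_exp_sub_one_mul_lt {a b : ℝ} (hab : b < a) (ha1 : a ≤ 1)
    (hb : 0 ≤ b) : ∃ s : ℝ, (Real.exp s - 1) * b < s * a := by
  refine ⟨(a - b) / 2, ?_⟩
  have h := Real.abs_exp_sub_one_sub_id_le (x := (a - b) / 2)
    (abs_le.2 ⟨by linarith, by linarith⟩)
  have h2 := mul_le_mul_of_nonneg_right (abs_le.1 h).2 hb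
  have hs : 0 < (a - b) / 2 := by linarith
  nlinarith [mul_pos hs hs, mul_nonneg (mul_pos hs hs).le (by linarith : (0 : ℝ) ≤ 1 - b)]

end Pointwise

section Entropy

variable {α : Type*} [MeasureSpace α]

lemma dens_nonneg (ρ : Measure α) (x : α) : 0 ≤ dens ρ x := ENNReal.toReal_nonneg

lemma measurable_dens (ρ : Measure α) : Measurable (dens ρ) :=
  (Measure.measurable_rnDeriv ρ volume).ennreal_toReal

lemma integrable_dens (ρ : Measure α) [IsFiniteMeasure ρ] : Integrable (dens ρ) volume :=
  Measure.integrable_toReal_rnDeriv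

lemma entropy_lt_top_iff (ρ : Measure α) :
    entropy ρ < ⊤ ↔ ρ ≪ (volume : Measure α) ∧
      Integrable (fun x => dens ρ x * Real.log (dens ρ x)) (volume : Measure α) := by
  unfold entropy
  split_ifs with h
  · simp [h, EReal.coe_lt_top]
  · simp [h]

lemma entropy_eq_coe {ρ : Measure α} (h : entropy ρ < ⊤) :
    entropy ρ = ((∫ x, dens ρ x * Real.log (dens ρ x) : ℝ) : EReal) := by
  unfold entropy
  rw [if_pos ((entropy_lt_top_iff ρ).1 h)]

lemma dens_convexComb [SigmaFinite (volume : Measure α)] (ρ₀ ρ₁ : Measure α)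
    [IsFiniteMeasure ρ₀] [IsFiniteMeasure ρ₁] {a b : ℝ} (ha : 0 ≤ a) (hb : 0 ≤ b) :
    dens (ENNReal.ofReal a • ρ₀ + ENNReal.ofReal b • ρ₁) =ᵐ[volume]
      fun x => a * dens ρ₀ x + b * dens ρ₁ x := by
  have := ρ₀.smul_finite (ENNReal.ofReal_ne_top (r := a))
  have := ρ₁.smul_finite (ENNReal.ofReal_ne_top (r := b))
  filter_upwards [Measure.rnDeriv_add' (ENNReal.ofReal a • ρ₀) (ENNReal.ofReal b • ρ₁) volume,
    Measure.rnDeriv_smul_left_of_ne_top' ρ₀ volume (ENNReal.ofReal_ne_top (r := a)),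
    Measure.rnDeriv_smul_left_of_ne_top' ρ₁ volume (ENNReal.ofReal_ne_top (r := b)),
    Measure.rnDeriv_lt_top ρ₀ volume, Measure.rnDeriv_lt_top ρ₁ volume] with x h1 h2 h3 h4 h5
  simp only [dens, h1, Pi.add_apply, h2, h3, Pi.smul_apply, smul_eq_mul]
  rw [ENNReal.toReal_add (ENNReal.mul_ne_top ENNReal.ofReal_ne_top h4.ne)
    (ENNReal.mul_ne_top ENNReal.ofReal_ne_top h5.ne)]
  simp [ENNReal.toReal_mul, ENNReal.toReal_ofReal ha, ENNReal.toReal_ofReal hb]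

/-- Quantitative convexity of the entropy: the convexity gap is controlled from below by the
values of the measures on any measurable set. -/
lemma entropy_convexComb [SigmaFinite (volume : Measure α)] (ρ₀ ρ₁ : Measure α)
    [IsFiniteMeasure ρ₀] [IsFiniteMeasure ρ₁] (h₀ : entropy ρ₀ < ⊤) (h₁ : entropy ρ₁ < ⊤)
    {t : ℝ} (ht0 : 0 < t) (ht1 : t < 1) {B : Set α} (hB : MeasurableSet B) (s : ℝ) :
    entropy (ENNReal.ofReal (1 - t) • ρ₀ + ENNReal.ofReal t • ρ₁) ≤
      (((1 - t) * (∫ x, dens ρ₀ x * Real.log (dens ρ₀ x)) +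
          t * (∫ x, dens ρ₁ x * Real.log (dens ρ₁ x)) -
        (1 - t) * (s * ρ₀.real B - (Real.exp s - 1) *
          ((1 - t) * ρ₀.real B + t * ρ₁.real B)) : ℝ) : EReal) := by
  obtain ⟨ac₀, i₀⟩ := (entropy_lt_top_iff ρ₀).1 h₀
  obtain ⟨ac₁, i₁⟩ := (entropy_lt_top_iff ρ₁).1 h₁
  set ρ := ENNReal.ofReal (1 - t) • ρ₀ + ENNReal.ofReal t • ρ₁ with hρ
  have hd : dens ρ =ᵐ[volume] fun x => (1 - t) * dens ρ₀ x + t * dens ρ₁ x :=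
    dens_convexComb ρ₀ ρ₁ (by linarith) ht0.le
  have d₀ := integrable_dens ρ₀
  have d₁ := integrable_dens ρ₁
  have iU : Integrable (fun x => (1 - t) * (dens ρ₀ x * Real.log (dens ρ₀ x)) +
      t * (dens ρ₁ x * Real.log (dens ρ₁ x))) := (i₀.const_mul _).add (i₁.const_mul _)
  have iE : Integrable (fun x => (1 - t) * Real.log (1 - t) * dens ρ₀ x +
      t * Real.log t * dens ρ₁ x) := (d₀.const_mul _).add (d₁.const_mul _)
  have hm : Measurable (fun x => dens ρ x * Real.log (dens ρ x)) :=
    (measurable_dens ρ).mul (measurable_dens ρ).log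
  have i : Integrable (fun x => dens ρ x * Real.log (dens ρ x)) := by
    refine (iU.norm.add iE.norm).mono' hm.aestronglyMeasurable ?_
    filter_upwards [hd] with x hx
    have hl := le_mul_log_convexComb ht0 ht1 (dens_nonneg ρ₀ x) (dens_nonneg ρ₁ x)
    have hu := mul_log_convexComb_le ht0 ht1 (dens_nonneg ρ₀ x) (dens_nonneg ρ₁ x) 0
    rw [Real.exp_zero] at hu
    simp only [hx, Pi.add_apply, Real.norm_eq_abs]
    refine abs_le.2 ⟨?_, ?_⟩
    · linarith [neg_abs_le ((1 - t) * (dens ρ₀ x * Real.log (dens ρ₀ x)) +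
        t * (dens ρ₁ x * Real.log (dens ρ₁ x))),
        neg_abs_le ((1 - t) * Real.log (1 - t) * dens ρ₀ x + t * Real.log t * dens ρ₁ x)]
    · linarith [le_abs_self ((1 - t) * (dens ρ₀ x * Real.log (dens ρ₀ x)) +
        t * (dens ρ₁ x * Real.log (dens ρ₁ x))),
        abs_nonneg ((1 - t) * Real.log (1 - t) * dens ρ₀ x + t * Real.log t * dens ρ₁ x)]
  have ac : ρ ≪ volume := (ac₀.smul_left _).add_left (ac₁.smul_left _)
  rw [entropy_eq_coe ((entropy_lt_top_iff ρ).2 ⟨ac, i⟩), EReal.coe_le_coe_iff]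
  have iM : Integrable (fun x => (Real.exp s - 1) * ((1 - t) * dens ρ₀ x + t * dens ρ₁ x)) :=
    ((d₀.const_mul _).add (d₁.const_mul _)).const_mul _
  have iG : Integrable (fun x => (1 - t) * (s * dens ρ₀ x - (Real.exp s - 1) *
      ((1 - t) * dens ρ₀ x + t * dens ρ₁ x))) :=
    ((d₀.const_mul s).sub iM).const_mul _
  have hmain : (∫ x, dens ρ x * Real.log (dens ρ x)) + (∫ x, B.indicator (fun x =>
      (1 - t) * (s * dens ρ₀ x - (Real.exp s - 1) *
      ((1 - t) * dens ρ₀ x + t * dens ρ₁ x))) x) ≤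
      ∫ x, ((1 - t) * (dens ρ₀ x * Real.log (dens ρ₀ x)) +
        t * (dens ρ₁ x * Real.log (dens ρ₁ x))) := by
    rw [← integral_add i (iG.indicator hB)]
    refine integral_mono_ae (i.add (iG.indicator hB)) iU ?_
    filter_upwards [hd] with x hx
    simp only [hx]
    by_cases hxB : x ∈ B
    · simpa [hxB] using
        mul_log_convexComb_le ht0 ht1 (dens_nonneg ρ₀ x) (dens_nonneg ρ₁ x) s
    · simpa [hxB] using
        mul_log_convexComb_le ht0 ht1 (dens_nonneg ρ₀ x) (dens_nonneg ρ₁ x) 0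
  have e₀ : ∫ x in B, dens ρ₀ x = ρ₀.real B := Measure.setIntegral_toReal_rnDeriv ac₀ B
  have e₁ : ∫ x in B, dens ρ₁ x = ρ₁.real B := Measure.setIntegral_toReal_rnDeriv ac₁ B
  rw [integral_indicator hB, integral_const_mul,
    integral_sub (d₀.const_mul s).integrableOn iM.integrableOn,
    integral_const_mul, integral_const_mul,
    integral_add (d₀.const_mul _).integrableOn (d₁.const_mul _).integrableOn,
    integral_const_mul, integral_const_mul, e₀, e₁,
    integral_add (i₀.const_mul _) (i₁.const_mul _), integral_const_mul, integral_const_mul]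
    at hmain
  linarith

lemma le_integral_dens_mul_log {ρ : Measure α} [SigmaFinite (volume : Measure α)]
    [SigmaFinite ρ] (h : entropy ρ < ⊤) {V : α → ℝ} (hV : Integrable V ρ)
    (hexp : Integrable (fun x => Real.exp (-V x))) :
    -(∫ x, V x ∂ρ) - Real.exp (-1) * (∫ x, Real.exp (-V x)) ≤
      ∫ x, dens ρ x * Real.log (dens ρ x) := by
  obtain ⟨ac, i⟩ := (entropy_lt_top_iff ρ).1 h
  have iV : Integrable (fun x => dens ρ x * V x) := by
    simpa [smul_eq_mul, dens] using (integrable_rnDeriv_smul_iff ac).2 hV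
  have eV : ∫ x, dens ρ x * V x = ∫ x, V x ∂ρ := by
    simpa [smul_eq_mul, dens] using integral_rnDeriv_smul (f := V) ac
  have iN : Integrable (fun x => -(dens ρ x * V x)) := iV.neg
  rw [← eV, ← integral_neg, ← integral_const_mul, ← integral_sub iN (hexp.const_mul _)]
  refine integral_mono (iN.sub (hexp.const_mul _)) i fun x => ?_
  have := mul_log_fenchel_young (dens_nonneg ρ x) (Real.exp_pos (-1 - V x)) 0
  rw [Real.log_exp, sub_eq_add_neg (-1), Real.exp_add, Real.exp_zero] at this
  simp only
  linarith

end Entropy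

section Product

variable {α : Type*} [MeasureSpace α] [SigmaFinite (volume : Measure α)]

lemma dens_prod {μ ν : Measure α} [SigmaFinite μ] [SigmaFinite ν]
    (hμ : μ ≪ volume) (hν : ν ≪ volume) :
    dens (μ.prod ν) =ᵐ[volume] fun z => dens μ z.1 * dens ν z.2 := by
  have h : μ.prod ν = (volume : Measure (α × α)).withDensity
      (fun z => μ.rnDeriv volume z.1 * ν.rnDeriv volume z.2) := by
    rw [Measure.volume_eq_prod, ← prod_withDensity (Measure.measurable_rnDeriv _ _)
      (Measure.measurable_rnDeriv _ _), Measure.withDensity_rnDeriv_eq _ _ hμ,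
      Measure.withDensity_rnDeriv_eq _ _ hν]
  have hm : Measurable (fun z : α × α => μ.rnDeriv volume z.1 * ν.rnDeriv volume z.2) := by
    fun_prop
  have h2 := Measure.rnDeriv_withDensity (volume : Measure (α × α)) hm
  rw [← h] at h2
  filter_upwards [h2] with z hz
  simp [dens, hz]

lemma entropy_prod_lt_top {μ ν : Measure α} [IsFiniteMeasure μ] [IsFiniteMeasure ν]
    (hμ : entropy μ < ⊤) (hν : entropy ν < ⊤) : entropy (μ.prod ν) < ⊤ := by
  obtain ⟨ac₀, i₀⟩ := (entropy_lt_top_iff μ).1 hμ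
  obtain ⟨ac₁, i₁⟩ := (entropy_lt_top_iff ν).1 hν
  refine (entropy_lt_top_iff _).2 ⟨ac₀.prod ac₁, ?_⟩
  have h := (i₀.mul_prod (integrable_dens ν)).add ((integrable_dens μ).mul_prod i₁)
  refine h.congr ?_
  filter_upwards [dens_prod ac₀ ac₁] with z hz
  simp only [hz, Pi.add_apply]
  by_cases h0 : dens μ z.1 = 0
  · simp [h0]
  by_cases h1 : dens ν z.2 = 0
  · simp [h1]
  rw [Real.log_mul h0 h1]
  ring

end Product

section Transport

variable {α : Type*} [MeasureSpace α]

lemma IsCoupling.isProbabilityMeasure {γ : Measure (α × α)} {μ ν : Measure α}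
    [hμ : IsProbabilityMeasure μ] (h : IsCoupling γ μ ν) : IsProbabilityMeasure γ := by
  refine ⟨?_⟩
  rw [← Measure.fst_univ, h.1, measure_univ]

lemma IsCoupling.real_snd {γ : Measure (α × α)} {μ ν : Measure α}
    (h : IsCoupling γ μ ν) {A : Set α} (hA : MeasurableSet A) :
    γ.real (Prod.snd ⁻¹' A) = ν.real A := by
  rw [← h.2, measureReal_def, measureReal_def, Measure.snd_apply hA]

lemma IsCoupling.convexComb {γ₀ γ₁ : Measure (α × α)} {μ ν₀ ν₁ : Measure α}
    (h₀ : IsCoupling γ₀ μ ν₀) (h₁ : IsCoupling γ₁ μ ν₁) {t : ℝ} (ht0 : 0 < t) (ht1 : t < 1) :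
    IsCoupling (ENNReal.ofReal (1 - t) • γ₀ + ENNReal.ofReal t • γ₁) μ
      (ENNReal.ofReal (1 - t) • ν₀ + ENNReal.ofReal t • ν₁) := by
  constructor
  · rw [Measure.fst_add, Measure.fst, Measure.map_smul, Measure.fst, Measure.map_smul]
    change ENNReal.ofReal (1 - t) • γ₀.fst + ENNReal.ofReal t • γ₁.fst = μ
    rw [h₀.1, h₁.1, ← add_smul, ← ENNReal.ofReal_add (by linarith) ht0.le]
    simp
  · rw [Measure.snd_add, Measure.snd, Measure.map_smul, Measure.snd, Measure.map_smul]
    change ENNReal.ofReal (1 - t) • γ₀.snd + ENNReal.ofReal t • γ₁.snd = _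
    rw [h₀.2, h₁.2]

lemma exists_coupling_of_transportCost_lt {c : α × α → ℝ} {ε : ℝ} (hε : 0 < ε)
    {μ ν : Measure α} {r : ℝ} (h : transportCost c ε μ ν < (r : EReal)) :
    ∃ γ, IsCoupling γ μ ν ∧ entropy γ < ⊤ ∧ costInt c γ ≠ ⊤ ∧
      (costInt c γ).toReal + ε * (∫ z, dens γ z * Real.log (dens γ z)) < r := by
  simp only [transportCost, iInf_lt_iff] at h
  obtain ⟨γ, hγ, h⟩ := h
  have he : entropy γ < ⊤ := by
    by_contra hcon
    rw [not_lt_top_iff.1 hcon, EReal.coe_mul_top_of_pos hε,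
      EReal.add_top_of_ne_bot (EReal.coe_ennreal_ne_bot _)] at h
    exact not_top_lt h
  rw [entropy_eq_coe he, ← EReal.coe_mul] at h
  have hc : costInt c γ ≠ ⊤ := by
    intro hcon
    rw [hcon, EReal.coe_ennreal_top, EReal.top_add_coe] at h
    exact not_top_lt h
  refine ⟨γ, hγ, he, hc, ?_⟩
  rw [← EReal.coe_ennreal_toReal hc, ← EReal.coe_add, EReal.coe_lt_coe_iff] at h
  exact h

lemma transportCost_le {c : α × α → ℝ} {ε : ℝ} (hε : 0 < ε) {μ ν : Measure α}
    {γ : Measure (α × α)} (hγ : IsCoupling γ μ ν) {e : ℝ} (he : entropy γ ≤ (e : EReal))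
    (hc : costInt c γ ≠ ⊤) :
    transportCost c ε μ ν ≤ (((costInt c γ).toReal + ε * e : ℝ) : EReal) := by
  refine (iInf₂_le γ hγ).trans ?_
  rw [EReal.coe_add, EReal.coe_ennreal_toReal hc, EReal.coe_mul]
  gcongr

lemma costInt_convexComb (c : α × α → ℝ) (γ₀ γ₁ : Measure (α × α)) {a b : ℝ}
    (ha : 0 ≤ a) (hb : 0 ≤ b) (h₀ : costInt c γ₀ ≠ ⊤) (h₁ : costInt c γ₁ ≠ ⊤) :
    costInt c (ENNReal.ofReal a • γ₀ + ENNReal.ofReal b • γ₁) ≠ ⊤ ∧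
    (costInt c (ENNReal.ofReal a • γ₀ + ENNReal.ofReal b • γ₁)).toReal =
      a * (costInt c γ₀).toReal + b * (costInt c γ₁).toReal := by
  have h : costInt c (ENNReal.ofReal a • γ₀ + ENNReal.ofReal b • γ₁) =
      ENNReal.ofReal a * costInt c γ₀ + ENNReal.ofReal b * costInt c γ₁ := by
    simp [costInt, lintegral_add_measure, lintegral_smul_measure]
  have e₀ := ENNReal.mul_ne_top (ENNReal.ofReal_ne_top (r := a)) h₀
  have e₁ := ENNReal.mul_ne_top (ENNReal.ofReal_ne_top (r := b)) h₁
  rw [h]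
  refine ⟨ENNReal.add_ne_top.2 ⟨e₀, e₁⟩, ?_⟩
  rw [ENNReal.toReal_add e₀ e₁]
  simp [ENNReal.toReal_mul, ENNReal.toReal_ofReal ha, ENNReal.toReal_ofReal hb]

/-- Distinct second marginals force a uniform convexity gap. -/
lemma exists_entropy_gap [SigmaFinite (volume : Measure α)] {μ ν₀ ν₁ : Measure α}
    [IsProbabilityMeasure μ] [IsProbabilityMeasure ν₀] [IsProbabilityMeasure ν₁]
    (hne : ν₀ ≠ ν₁) {t : ℝ} (ht0 : 0 < t) (ht1 : t < 1) :
    ∃ δ > 0, ∀ γ₀ γ₁ : Measure (α × α), IsCoupling γ₀ μ ν₀ → IsCoupling γ₁ μ ν₁ →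
      entropy γ₀ < ⊤ → entropy γ₁ < ⊤ →
      entropy (ENNReal.ofReal (1 - t) • γ₀ + ENNReal.ofReal t • γ₁) ≤
        (((1 - t) * (∫ z, dens γ₀ z * Real.log (dens γ₀ z)) +
          t * (∫ z, dens γ₁ z * Real.log (dens γ₁ z)) - δ : ℝ) : EReal) := by
  have hA : ∃ A, MeasurableSet A ∧ ν₁.real A < ν₀.real A := by
    by_contra! hcon
    refine hne (Measure.ext fun A hA => ?_)
    have h1 := hcon A hA
    have h2 := hcon Aᶜ hA.compl
    rw [probReal_compl_eq_one_sub hA, probReal_compl_eq_one_sub hA] at h2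
    have h3 : ν₀.real A = ν₁.real A := by linarith
    exact (measureReal_eq_measureReal_iff).1 h3
  obtain ⟨A, hA, hlt⟩ := hA
  have hb : (1 - t) * ν₀.real A + t * ν₁.real A < ν₀.real A := by nlinarith
  have ha1 : ν₀.real A ≤ 1 := measureReal_le_one
  have h1t : 0 < 1 - t := by linarith
  obtain ⟨s, hs⟩ := exists_exp_sub_one_mul_lt hb ha1 (by positivity)
  refine ⟨_, mul_pos h1t (sub_pos.2 hs), fun γ₀ γ₁ h₀ h₁ e₀ e₁ => ?_⟩
  have := h₀.isProbabilityMeasure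
  have := h₁.isProbabilityMeasure
  have h := entropy_convexComb γ₀ γ₁ e₀ e₁ ht0 ht1 (measurable_snd hA) s
  rwa [h₀.real_snd hA, h₁.real_snd hA] at h

end Transport

section Euclidean

variable {d : ℕ}

lemma integrable_norm_sq_of_isP2 {ρ : Measure (Euc d)} (h : IsP2 ρ) :
    Integrable (fun x => ‖x‖ ^ 2) ρ := by
  refine ⟨by fun_prop, ?_⟩
  have h2 := h.2
  simp only [M2] at h2
  simpa [HasFiniteIntegral, enorm_pow, enorm_eq_nnnorm] using h2

lemma integrable_exp_neg_norm_sq : Integrable (fun x : Euc d => Real.exp (-‖x‖ ^ 2)) := by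
  have h := GaussianFourier.integral_rexp_neg_mul_sq_norm (V := Euc d) one_pos
  refine not_imp_comm.1 integral_undef ?_
  simp only [neg_mul, one_mul] at h
  rw [h]
  positivity

lemma IsCoupling.integrable_norm_sq {γ : Measure (Euc d × Euc d)} {μ ν : Measure (Euc d)}
    (h : IsCoupling γ μ ν) (hμ : IsP2 μ) (hν : IsP2 ν) :
    Integrable (fun z => ‖z.1‖ ^ 2 + ‖z.2‖ ^ 2) γ ∧
      ∫ z, (‖z.1‖ ^ 2 + ‖z.2‖ ^ 2) ∂γ = (∫ x, ‖x‖ ^ 2 ∂μ) + ∫ y, ‖y‖ ^ 2 ∂ν := by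
  have i₀ := integrable_norm_sq_of_isP2 hμ
  have i₁ := integrable_norm_sq_of_isP2 hν
  rw [← h.1] at i₀
  rw [← h.2] at i₁
  have j₀ : Integrable (fun z : Euc d × Euc d => ‖z.1‖ ^ 2) γ := i₀.comp_measurable measurable_fst
  have j₁ : Integrable (fun z : Euc d × Euc d => ‖z.2‖ ^ 2) γ := i₁.comp_measurable measurable_snd
  refine ⟨j₀.add j₁, ?_⟩
  rw [integral_add j₀ j₁, ← h.1, ← h.2, Measure.fst, Measure.snd,
    integral_map measurable_fst.aemeasurable (by fun_prop),
    integral_map measurable_snd.aemeasurable (by fun_prop)]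

lemma bot_lt_transportCost {c : Euc d × Euc d → ℝ} {ε : ℝ} (hε : 0 < ε)
    {μ ν : Measure (Euc d)} (hμ : IsP2 μ) (hν : IsP2 ν) : ⊥ < transportCost c ε μ ν := by
  have := hμ.1
  set K : ℝ := -((∫ x, ‖x‖ ^ 2 ∂μ) + ∫ y, ‖y‖ ^ 2 ∂ν) -
    Real.exp (-1) * ∫ z : Euc d × Euc d, Real.exp (-(‖z.1‖ ^ 2 + ‖z.2‖ ^ 2)) with hK
  by_contra hcon
  rw [not_bot_lt_iff] at hcon
  obtain ⟨γ, hγ, he, -, hlt⟩ := exists_coupling_of_transportCost_lt (c := c) (μ := μ) (ν := ν)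
    hε (r := ε * K) (hcon ▸ EReal.bot_lt_coe _)
  have := hγ.isProbabilityMeasure
  obtain ⟨i, hi⟩ := hγ.integrable_norm_sq hμ hν
  have hexp : Integrable (fun z : Euc d × Euc d => Real.exp (-(‖z.1‖ ^ 2 + ‖z.2‖ ^ 2))) := by
    refine (integrable_exp_neg_norm_sq.mul_prod integrable_exp_neg_norm_sq).congr ?_
    filter_upwards with z
    rw [← Real.exp_add]
    ring_nf
  have h := le_integral_dens_mul_log he i hexp
  rw [hi] at h
  have h2 := mul_le_mul_of_nonneg_left h hε.le
  have h3 : 0 ≤ (costInt c γ).toReal := ENNReal.toReal_nonneg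
  linarith

lemma transportCost_lt_top {c : Euc d × Euc d → ℝ} {C₁ ε : ℝ} (hε : 0 < ε)
    (hcbound : ∀ x y : Euc d, c (x, y) ≤ C₁ * (‖x‖ ^ 2 + ‖y‖ ^ 2))
    {μ ν : Measure (Euc d)} (hμ : IsP2 μ) (hν : IsP2 ν) (hHμ : entropy μ < ⊤)
    (hHν : entropy ν < ⊤) : transportCost c ε μ ν < ⊤ := by
  have := hμ.1
  have := hν.1
  have hγ : IsCoupling (μ.prod ν) μ ν := ⟨by simp, by simp⟩
  have hc : costInt c (μ.prod ν) ≠ ⊤ := by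
    refine ne_top_of_le_ne_top
      ((hγ.integrable_norm_sq hμ hν).1.const_mul C₁).lintegral_lt_top.ne ?_
    exact lintegral_mono fun z => ENNReal.ofReal_le_ofReal (hcbound z.1 z.2)
  exact (transportCost_le hε hγ (entropy_eq_coe (entropy_prod_lt_top hHμ hHν)).le hc).trans_lt
    (EReal.coe_lt_top _)

end Euclidean

/-- Lemma 5.6, strict convexity of `ν ↦ W_{c,ε}(μ,ν)` on `𝒫₂^r(ℝ^d)`. -/
theorem statement_4
    (d : ℕ) (c : Euc d × Euc d → ℝ) (C₁ ε : ℝ) (hC₁ : 0 < C₁) (hε : 0 < ε)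
    (hccont : Continuous c)
    (hcbound : ∀ x y : Euc d, 0 ≤ c (x, y) ∧ c (x, y) ≤ C₁ * (‖x‖ ^ 2 + ‖y‖ ^ 2))
    (μ : Measure (Euc d)) (hμ : IsP2r μ) (hHμ : entropy μ < ⊤) :
    ∀ ν₀ ν₁ : Measure (Euc d), ν₀ ≠ ν₁ → IsP2r ν₀ → IsP2r ν₁ →
      entropy ν₀ < ⊤ → entropy ν₁ < ⊤ → ∀ t : ℝ, 0 < t → t < 1 →
        transportCost c ε μ (ENNReal.ofReal (1 - t) • ν₀ + ENNReal.ofReal t • ν₁) <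
          ((1 - t : ℝ) : EReal) * transportCost c ε μ ν₀ +
            ((t : ℝ) : EReal) * transportCost c ε μ ν₁ := by
  intro ν₀ ν₁ hne hν₀ hν₁ hH₀ hH₁ t ht0 ht1
  have := hμ.1.1
  have := hν₀.1.1
  have := hν₁.1.1
  have hcb : ∀ x y : Euc d, c (x, y) ≤ C₁ * (‖x‖ ^ 2 + ‖y‖ ^ 2) := fun x y => (hcbound x y).2
  obtain ⟨w₀, hw₀⟩ : ∃ w : ℝ, (w : EReal) = transportCost c ε μ ν₀ :=
    ⟨_, EReal.coe_toReal (transportCost_lt_top hε hcb hμ.1 hν₀.1 hHμ hH₀).ne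
      (bot_lt_transportCost hε hμ.1 hν₀.1).ne'⟩
  obtain ⟨w₁, hw₁⟩ : ∃ w : ℝ, (w : EReal) = transportCost c ε μ ν₁ :=
    ⟨_, EReal.coe_toReal (transportCost_lt_top hε hcb hμ.1 hν₁.1 hHμ hH₁).ne
      (bot_lt_transportCost hε hμ.1 hν₁.1).ne'⟩
  obtain ⟨δ, hδ, hgap⟩ := exists_entropy_gap (μ := μ) hne ht0 ht1
  have hεδ : 0 < ε * δ := mul_pos hε hδ
  obtain ⟨γ₀, hγ₀, e₀, c₀, l₀⟩ := exists_coupling_of_transportCost_lt (c := c) hε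
    (r := w₀ + ε * δ) (by rw [← hw₀, EReal.coe_lt_coe_iff]; linarith)
  obtain ⟨γ₁, hγ₁, e₁, c₁, l₁⟩ := exists_coupling_of_transportCost_lt (c := c) hε
    (r := w₁ + ε * δ) (by rw [← hw₁, EReal.coe_lt_coe_iff]; linarith)
  obtain ⟨hc, hceq⟩ := costInt_convexComb c γ₀ γ₁ (a := 1 - t) (b := t) (by linarith) ht0.le c₀ c₁
  refine (transportCost_le hε (hγ₀.convexComb hγ₁ ht0 ht1)
    (hgap γ₀ γ₁ hγ₀ hγ₁ e₀ e₁) hc).trans_lt ?_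
  rw [← hw₀, ← hw₁, ← EReal.coe_mul, ← EReal.coe_mul, ← EReal.coe_add, EReal.coe_lt_coe_iff, hceq]
  have m₀ := mul_lt_mul_of_pos_left l₀ (by linarith : 0 < 1 - t)
  have m₁ := mul_lt_mul_of_pos_left l₁ ht0
  linarith
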